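/- Suppose in addition that there are a neighborhood U of s₀ and a twice continuously differentiable probability density h₀ : ℝ → ℝ such that g(t|s) = h₀(t − m(s)) for all s ∈ U and all t ∈ ℝ, and that m is affine on U (homoscedastic model with linear conditional mean). Define N₁(B, b') = ∫_ℝ ∫_{ℝ^d} K̃_{b'}( t − ∇m(s₀)ᵀ(s − s₀) − θ₀ ) K_B(s − s₀) f(t, s) ds dt and D(B) = ∫_{ℝ^d} K_B(s − s₀) p(s) ds. Then, as b' → 0⁺ and ‖B‖ → 0 along any sequences of positive reals and nonsingular d×d matrices, N₁(B, b')/D(B) − g(θ₀|s₀) = (1/2) μ₂(K̃) h₀''(ε) b'² + o(b'² + tr(BᵀB)); that is, the bias constant C₂,₁ of the linear-adjustment estimator vanishes and its smoothing bias in the summary-statistics space is of smaller order than tr(BᵀB). -/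

import Mathlib

open MeasureTheory Filter Matrix Asymptotics
open scoped Topology

lemma aux_bound_radius {E : Type*} [NormedAddCommGroup E] {k : E → ℝ} (h : HasCompactSupport k) :
    ∃ R : ℝ, 0 ≤ R ∧ ∀ u, k u ≠ 0 → ‖u‖ ≤ R := by
  obtain ⟨R, hR⟩ := (IsCompact.isBounded h).exists_norm_le
  refine ⟨max R 0, le_max_right _ _, fun u hu => (hR u (subset_tsupport _ hu)).trans (le_max_left _ _)⟩

lemma aux_integrable {E : Type*} [NormedAddCommGroup E] [MeasurableSpace E] [BorelSpace E]
    {μ : Measure E} [IsFiniteMeasureOnCompacts μ] {k q : E → ℝ} (hm : Measurable k)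
    (hs : HasCompactSupport k) (hb : ∃ M, ∀ u, |k u| ≤ M) (hq : Continuous q) :
    Integrable (fun u => k u * q u) μ := by
  obtain ⟨M, hM⟩ := hb
  have h1 : IntegrableOn (fun u => k u * q u) (tsupport k) μ := by
    apply Integrable.bdd_mul (c := M)
    · exact hq.continuousOn.integrableOn_compact hs
    · exact hm.aestronglyMeasurable
    · exact Eventually.of_forall hM
  rw [← integrableOn_iff_integrable_of_support_subset (s := tsupport k)]
  · exact h1
  · intro x hx
    apply subset_tsupport
    intro h
    exact hx (by simp [h])

lemma aux_taylor {h : ℝ → ℝ} (hh : ContDiff ℝ 2 h) (x₀ : ℝ) :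
    (fun x => h (x₀ + x) - h x₀ - deriv h x₀ * x - (1/2) * deriv (deriv h) x₀ * x ^ 2)
      =o[𝓝 0] (fun x : ℝ => x ^ 2) := by
  have h1 := taylor_isLittleO_univ (x₀ := x₀) (n := 2) (by exact_mod_cast hh)
  have h2 : Tendsto (fun x : ℝ => x₀ + x) (𝓝 0) (𝓝 x₀) := by
    have : Continuous (fun x : ℝ => x₀ + x) := by fun_prop
    simpa using this.tendsto 0
  have h3 := h1.comp_tendsto h2
  refine h3.congr ?_ ?_
  · intro x
    simp only [Function.comp, taylorWithinEval_succ, taylor_within_zero_eval,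
      iteratedDerivWithin_univ, iteratedDeriv_succ, iteratedDeriv_zero]
    simp
    ring
  · intro x; simp

lemma aux_smooth {h k : ℝ → ℝ} (hh : ContDiff ℝ 2 h) (x₀ : ℝ) (hm : Measurable k)
    (hs : HasCompactSupport k) (hb : ∃ M, ∀ u, |k u| ≤ M) (hk0 : ∀ u, 0 ≤ k u)
    (hki : ∫ u, k u = 1) (hke : ∀ u, k (-u) = k u) :
    (fun b : ℝ => (∫ u, k u * h (x₀ + b * u)) - h x₀ -
      (1/2) * (∫ u, u^2 * k u) * deriv (deriv h) x₀ * b ^ 2) =o[𝓝 0] (fun b : ℝ => b ^ 2) := by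
  have hodd : ∫ u, k u * u = 0 := by
    have h1 : ∫ u, k (-u) * (-u) = ∫ u, k u * u := integral_neg_eq_self (fun u => k u * u) volume
    have h2 : ∫ u, k (-u) * (-u) = - ∫ u, k u * u := by
      rw [← integral_neg]; congr 1; ext u; rw [hke]; ring
    linarith
  have hi0 : Integrable (fun u => k u) := by
    simpa using aux_integrable (μ := volume) hm hs hb (continuous_const (y := (1:ℝ)))
  have hi1 : Integrable (fun u => k u * u) := aux_integrable hm hs hb continuous_id
  have hi2 : Integrable (fun u => k u * u ^ 2) := aux_integrable hm hs hb (by fun_prop)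
  set μ2 := ∫ u, k u * u ^ 2 with hμ2
  have hμ2' : ∫ u, u^2 * k u = μ2 := by rw [hμ2]; congr 1; ext; ring
  have hμ0 : 0 ≤ μ2 := integral_nonneg (fun u => mul_nonneg (hk0 u) (sq_nonneg u))
  obtain ⟨R, hR0, hR⟩ := aux_bound_radius hs
  set r : ℝ → ℝ := fun x => h (x₀ + x) - h x₀ - deriv h x₀ * x - (1/2) * deriv (deriv h) x₀ * x ^ 2
    with hr
  have hhc : Continuous h := hh.continuous
  have hrc : Continuous r := by rw [hr]; fun_prop
  have key : ∀ b : ℝ, (∫ u, k u * h (x₀ + b * u)) - h x₀ -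
      (1/2) * (∫ u, u^2 * k u) * deriv (deriv h) x₀ * b ^ 2 = ∫ u, k u * r (b * u) := by
    intro b
    have e : ∀ u, k u * h (x₀ + b * u) = k u * r (b * u) + (h x₀ * k u + (deriv h x₀ * b * (k u * u) +
       ((1/2) * deriv (deriv h) x₀ * b^2) * (k u * u^2))) := by
      intro u; simp only [hr]; ring
    have i1 : Integrable (fun u => k u * r (b * u)) := aux_integrable hm hs hb (by fun_prop)
    simp_rw [e]
    rw [integral_add i1, integral_add (hi0.const_mul _), integral_add (hi1.const_mul _) (hi2.const_mul _),
      integral_const_mul, integral_const_mul, integral_const_mul, hki, hodd, hμ2', ← hμ2]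
    · ring
    · exact (hi1.const_mul _).add (hi2.const_mul _)
    · exact (hi0.const_mul _).add ((hi1.const_mul _).add (hi2.const_mul _))
  simp_rw [key]
  rw [isLittleO_iff]
  intro c hc
  have hc' : 0 < c / (μ2 + 1) := by positivity
  have ht := (isLittleO_iff.1 (aux_taylor hh x₀)) hc'
  obtain ⟨δ, hδ, hball⟩ := Metric.eventually_nhds_iff.1 ht
  have hnear : ∀ᶠ b : ℝ in 𝓝 0, |b| < δ / (R + 1) := by
    have : Tendsto (fun b : ℝ => |b|) (𝓝 0) (𝓝 0) := by simpa using (continuous_abs (G := ℝ)).tendsto 0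
    exact this.eventually_lt_const (by positivity)
  filter_upwards [hnear] with b hbn
  have hbd : ∀ u, ‖k u * r (b * u)‖ ≤ (c / (μ2 + 1) * b ^ 2) * (k u * u ^ 2) := by
    intro u
    by_cases hu : k u = 0
    · simp [hu]
    have hu' := hR u hu
    have hlt : |b * u| < δ := by
      rw [abs_mul]
      rw [Real.norm_eq_abs] at hu'
      rw [lt_div_iff₀ (by positivity)] at hbn
      nlinarith [abs_nonneg b, abs_nonneg u]
    have := hball (y := b * u) (by simpa [Real.dist_eq] using hlt)
    rw [norm_mul, Real.norm_of_nonneg (hk0 u)]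
    rw [Real.norm_of_nonneg (sq_nonneg (b * u))] at this
    calc k u * ‖r (b * u)‖ ≤ k u * (c / (μ2 + 1) * (b * u) ^ 2) :=
          mul_le_mul_of_nonneg_left this (hk0 u)
      _ = _ := by ring
  have := norm_integral_le_of_norm_le (hi2.const_mul _) (Eventually.of_forall hbd)
  rw [integral_const_mul, ← hμ2] at this
  refine this.trans ?_
  rw [Real.norm_of_nonneg (sq_nonneg b)]
  have : c / (μ2 + 1) * μ2 ≤ c := by
    rw [div_mul_eq_mul_div, div_le_iff₀ (by positivity)]; nlinarith
  nlinarith [sq_nonneg b]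

lemma aux_shift {h k : ℝ → ℝ} (θ m0 a b : ℝ) (hb : 0 < b) :
    ∫ t, k ((t - a - θ) / b) / b * h (t - m0 - a) = ∫ u, k u * h (θ - m0 + b * u) := by
  set G : ℝ → ℝ := fun u => k u * h (θ - m0 + b * u) with hG
  have e : ∀ t, k ((t - a - θ) / b) / b * h (t - m0 - a) = b⁻¹ * G ((t - (a + θ)) / b) := by
    intro t
    simp only [hG]
    have h1 : θ - m0 + b * ((t - (a + θ)) / b) = t - m0 - a := by field_simp; ring
    rw [h1, sub_sub t a θ]; ring
  simp_rw [e]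
  rw [integral_const_mul, integral_sub_right_eq_self (fun t => G (t / b)), Measure.integral_comp_div,
    abs_of_pos hb, smul_eq_mul, ← mul_assoc, inv_mul_cancel₀ hb.ne', one_mul]

lemma aux_cov {d : ℕ} (A : Matrix (Fin d) (Fin d) ℝ) (hA : A.det ≠ 0) (K p : (Fin d → ℝ) → ℝ)
    (hK : Measurable K) (hp : Measurable p) (s₀ : Fin d → ℝ) :
    ∫ s, |A.det|⁻¹ * K (A⁻¹.mulVec (s - s₀)) * p s = ∫ u, K u * p (s₀ + A.mulVec u) := by
  have hmeas : ∀ M : Matrix (Fin d) (Fin d) ℝ, Measurable (fun v : Fin d → ℝ => M.mulVec v) := by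
    intro M
    exact (Continuous.matrix_mulVec continuous_const continuous_id).measurable
  set G : (Fin d → ℝ) → ℝ := fun v => K (A⁻¹.mulVec v) * p (s₀ + v) with hG
  have hGm : Measurable G := by
    apply Measurable.mul
    · exact hK.comp (hmeas _)
    · exact hp.comp (by fun_prop)
  have e1 : ∀ s, |A.det|⁻¹ * K (A⁻¹.mulVec (s - s₀)) * p s = |A.det|⁻¹ * G (s - s₀) := by
    intro s; simp only [hG]; rw [add_sub_cancel]; ring
  have e2 : ∀ u, K u * p (s₀ + A.mulVec u) = G (Matrix.toLin' A u) := by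
    intro u; simp only [hG, Matrix.toLin'_apply, Matrix.mulVec_mulVec]
    rw [Matrix.nonsing_inv_mul _ (isUnit_iff_ne_zero.2 hA), Matrix.one_mulVec]
  simp_rw [e1, e2]
  rw [integral_const_mul, integral_sub_right_eq_self G]
  rw [← integral_map (f := G) (φ := fun u => Matrix.toLin' A u) (μ := volume)]
  · have := Real.map_matrix_volume_pi_eq_smul_volume_pi hA
    change _ = ∫ y, G y ∂(Measure.map (Matrix.toLin' A) volume)
    rw [this, integral_smul_measure, ENNReal.toReal_ofReal (abs_nonneg _), abs_inv, smul_eq_mul]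
  · exact (hmeas A).aemeasurable
  · exact hGm.aestronglyMeasurable

lemma aux_mulVec {d : ℕ} (A : Matrix (Fin d) (Fin d) ℝ) (u : Fin d → ℝ) :
    ‖A.mulVec u‖ ≤ d * Real.sqrt ((Aᵀ * A).trace) * ‖u‖ := by
  have htr : (Aᵀ * A).trace = ∑ j, ∑ i, A i j ^ 2 := by
    simp [Matrix.trace, Matrix.mul_apply, sq]
  have hent : ∀ i j, |A i j| ≤ Real.sqrt ((Aᵀ * A).trace) := by
    intro i j
    apply Real.abs_le_sqrt
    rw [htr]
    refine le_trans ?_ (Finset.single_le_sum (f := fun j => ∑ i, A i j ^ 2)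
      (fun j _ => Finset.sum_nonneg (fun i _ => sq_nonneg _)) (Finset.mem_univ j))
    exact Finset.single_le_sum (f := fun i => A i j ^ 2) (fun i _ => sq_nonneg _) (Finset.mem_univ i)
  rw [pi_norm_le_iff_of_nonneg (by positivity)]
  intro i
  simp only [Matrix.mulVec, dotProduct]
  calc ‖∑ j, A i j * u j‖ ≤ ∑ j, ‖A i j * u j‖ := norm_sum_le _ _
    _ ≤ ∑ _j : Fin d, Real.sqrt ((Aᵀ * A).trace) * ‖u‖ := by
        apply Finset.sum_le_sum
        intro j _
        rw [norm_mul]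
        exact mul_le_mul (hent i j) (norm_le_pi_norm u j) (norm_nonneg _) (Real.sqrt_nonneg _)
    _ = _ := by simp; ring

theorem linear_adjustment_bias_vanishes_homoscedastic_linear_mean
    (d : ℕ) (hd : 1 ≤ d)
    (f : ℝ → (Fin d → ℝ) → ℝ)
    (hf_meas : Measurable (Function.uncurry f))
    (hf_nonneg : ∀ t s, 0 ≤ f t s)
    (hf_bdd : ∃ M, ∀ t s, f t s ≤ M)
    (hf_int : ∫ x : ℝ × (Fin d → ℝ), f x.1 x.2 = 1)
    (hf_smooth : ContDiff ℝ 2 (Function.uncurry f))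
    (hf_d2bdd : ∃ M, ∀ x : ℝ × (Fin d → ℝ), ‖iteratedFDeriv ℝ 2 (Function.uncurry f) x‖ ≤ M)
    (p : (Fin d → ℝ) → ℝ) (hp_def : ∀ s, p s = ∫ t : ℝ, f t s)
    (g : ℝ → (Fin d → ℝ) → ℝ) (hg_def : ∀ t s, g t s = f t s / p s)
    (s₀ : Fin d → ℝ) (hps₀ : ∀ᶠ s in 𝓝 s₀, 0 < p s)
    (θ₀ : ℝ)
    (K : (Fin d → ℝ) → ℝ)
    (hK_meas : Measurable K)
    (hK_bdd : ∃ M, ∀ u, |K u| ≤ M)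
    (hK_supp : HasCompactSupport K)
    (hK_even : ∀ u, K (-u) = K u)
    (hK_int : (∫ u : Fin d → ℝ, K u) = 1)
    (μ2K : ℝ) (hμ2K_ne : μ2K ≠ 0)
    (hK_mom : ∀ i j, (∫ u : Fin d → ℝ, u i * u j * K u) = if i = j then μ2K else 0)
    (KB : Matrix (Fin d) (Fin d) ℝ → (Fin d → ℝ) → ℝ)
    (hKB : ∀ A u, KB A u = |A.det|⁻¹ * K (A⁻¹.mulVec u))
    (Kt : ℝ → ℝ)
    (hKt_meas : Measurable Kt)
    (hKt_bdd : ∃ M, ∀ u, |Kt u| ≤ M)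
    (hKt_supp : HasCompactSupport Kt)
    (hKt_nonneg : ∀ u, 0 ≤ Kt u)
    (hKt_int : (∫ u : ℝ, Kt u) = 1)
    (hKt_even : ∀ u, Kt (-u) = Kt u)
    (μ2Kt : ℝ) (hμ2Kt : μ2Kt = ∫ u : ℝ, u ^ 2 * Kt u)
    (Ktb : ℝ → ℝ → ℝ) (hKtb : ∀ c u, Ktb c u = Kt (u / c) / c)
    (m : (Fin d → ℝ) → ℝ) (hm_def : ∀ s, m s = ∫ t : ℝ, t * g t s)
    (ε : ℝ) (hε : ε = θ₀ - m s₀)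
    (gm : Fin d → ℝ) (hgm : ∀ i, gm i = fderiv ℝ m s₀ (Pi.single i 1))
    (h₀ : ℝ → ℝ) (hh₀_smooth : ContDiff ℝ 2 h₀)
    (hh₀_nonneg : ∀ t, 0 ≤ h₀ t) (hh₀_int : (∫ t : ℝ, h₀ t) = 1)
    (U : Set (Fin d → ℝ)) (hU : U ∈ 𝓝 s₀)
    (hhomo : ∀ s ∈ U, ∀ t, g t s = h₀ (t - m s))
    (hm_affine : ∃ (w : Fin d → ℝ) (c : ℝ), ∀ s ∈ U, m s = (∑ i, w i * s i) + c)
    (B : ℕ → Matrix (Fin d) (Fin d) ℝ)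
    (hBdet : ∀ n, (B n).det ≠ 0)
    (hB0 : Tendsto (fun n => ((B n)ᵀ * B n).trace) atTop (𝓝 0))
    (b' : ℕ → ℝ) (hb'pos : ∀ n, 0 < b' n) (hb'0 : Tendsto b' atTop (𝓝 0))
    (N₁ : ℕ → ℝ)
    (hN₁ : ∀ n, N₁ n =
      ∫ t : ℝ, ∫ s : Fin d → ℝ,
        Ktb (b' n) (t - gm ⬝ᵥ (s - s₀) - θ₀) * KB (B n) (s - s₀) * f t s)
    (D : ℕ → ℝ)
    (hD : ∀ n, D n = ∫ s : Fin d → ℝ, KB (B n) (s - s₀) * p s) :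
    (fun n =>
        N₁ n / D n - g θ₀ s₀ - (1 / 2) * μ2Kt * deriv (deriv h₀) ε * (b' n) ^ 2)
      =o[atTop] (fun n => (b' n) ^ 2 + ((B n)ᵀ * B n).trace) := by
  obtain ⟨w, c, hw⟩ := hm_affine
  have hs₀U : s₀ ∈ U := mem_of_mem_nhds hU
  obtain ⟨R, hR0, hR⟩ := aux_bound_radius hK_supp
  -- gradient
  have hgw : gm = w := by
    ext i
    have hL : HasFDerivAt (fun s : Fin d → ℝ => (∑ i, w i * s i) + c)
        (∑ i, w i • (ContinuousLinearMap.proj (R := ℝ) (φ := fun _ : Fin d => ℝ) i)) s₀ := by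
      apply HasFDerivAt.add_const
      apply HasFDerivAt.fun_sum
      intro i _
      exact (ContinuousLinearMap.proj (R := ℝ) (φ := fun _ : Fin d => ℝ) i).hasFDerivAt.const_mul (w i)
    have hm' : HasFDerivAt m _ s₀ := hL.congr_of_eventuallyEq (by
      filter_upwards [hU] with s hs using hw s hs)
    rw [hgm, hm'.fderiv]
    simp [Pi.single_apply]
  have hmU : ∀ s ∈ U, m s = m s₀ + gm ⬝ᵥ (s - s₀) := by
    intro s hs
    rw [hw s hs, hw s₀ hs₀U, hgw, dotProduct_sub]
    simp only [dotProduct]; ring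
  have hmc : ContinuousAt m s₀ := by
    have : ContinuousAt (fun s : Fin d → ℝ => (∑ i, w i * s i) + c) s₀ := 
      (Continuous.add (continuous_finset_sum _ fun i _ => by fun_prop) continuous_const).continuousAt
    exact this.congr (by filter_upwards [hU] with s hs using (hw s hs).symm)
  -- f formula
  have hff : ∀ᶠ s in 𝓝 s₀, s ∈ U ∧ ∀ t, f t s = p s * h₀ (t - m s) := by
    filter_upwards [hU, hps₀] with s hs hps
    refine ⟨hs, fun t => ?_⟩
    rw [← hhomo s hs t, hg_def]; field_simp
  -- continuity of p
  have hp_cont : ContinuousAt p s₀ := by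
    obtain ⟨x, hx⟩ : ∃ x, h₀ x ≠ 0 := by
      by_contra! hcon
      simp [hcon] at hh₀_int
    have hden : ContinuousAt (fun s => h₀ (x + m s₀ - m s)) s₀ :=
      ContinuousAt.comp (f := fun s => x + m s₀ - m s) hh₀_smooth.continuous.continuousAt
        (by fun_prop)
    have hnum : ContinuousAt (fun s => f (x + m s₀) s) s₀ := by
      have : Continuous (fun s => Function.uncurry f (x + m s₀, s)) :=
        hf_smooth.continuous.comp (by fun_prop)
      exact this.continuousAt
    have hne : h₀ (x + m s₀ - m s₀) ≠ 0 := by simpa using hx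
    refine (hnum.div hden hne).congr ?_
    filter_upwards [hff, hden.eventually_ne hne] with s hs hs2
    simp only [Pi.div_apply]
    rw [hs.2]; field_simp
  have hp_meas : Measurable p := by
    have : StronglyMeasurable (fun s => ∫ t : ℝ, f t s) :=
      StronglyMeasurable.integral_prod_left (f := f) hf_meas.stronglyMeasurable
    rw [show p = fun s => ∫ t : ℝ, f t s from funext hp_def]
    exact this.measurable
  have hp0 : 0 < p s₀ := hps₀.self_of_nhds
  have hrad : Tendsto (fun n => (d : ℝ) * Real.sqrt (((B n)ᵀ * B n).trace) * R) atTop (𝓝 0) := by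
    have h1 := (Real.continuous_sqrt.tendsto 0).comp hB0
    have h2 := (h1.const_mul (d : ℝ)).mul_const R
    simpa using h2
  have hBu : ∀ u, Tendsto (fun n => s₀ + (B n).mulVec u) atTop (𝓝 s₀) := by
    intro u
    have : Tendsto (fun n => (B n).mulVec u) atTop (𝓝 0) := by
      apply squeeze_zero_norm (fun n => aux_mulVec (B n) u)
      have h1 := (Real.continuous_sqrt.tendsto 0).comp hB0
      have h2 := (h1.const_mul (d : ℝ)).mul_const ‖u‖
      simpa using h2
    simpa using this.const_add s₀
  -- uniform closeness
  have hunif : ∀ V ∈ 𝓝 s₀, ∀ᶠ n in atTop, ∀ u, K u ≠ 0 → s₀ + (B n).mulVec u ∈ V := by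
    intro V hV
    obtain ⟨δ, hδ, hball⟩ := Metric.mem_nhds_iff.1 hV
    filter_upwards [hrad.eventually_lt_const hδ] with n hn u hu
    apply hball
    rw [Metric.mem_ball, dist_eq_norm, add_sub_cancel_left]
    refine (aux_mulVec _ _).trans_lt (lt_of_le_of_lt ?_ hn)
    exact mul_le_mul_of_nonneg_left (hR u hu) (by positivity)
  have hDlim : Tendsto D atTop (𝓝 (p s₀)) := by
    have hDe : D = fun n => ∫ u, K u * p (s₀ + (B n).mulVec u) := by
      ext n
      rw [hD]
      simp_rw [hKB]
      exact aux_cov (B n) (hBdet n) K p hK_meas hp_meas s₀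
    rw [hDe]
    have hlim : p s₀ = ∫ u, K u * p s₀ := by rw [integral_mul_const, hK_int, one_mul]
    rw [hlim]
    have hKi : Integrable K := by
      simpa using aux_integrable (μ := volume) hK_meas hK_supp hK_bdd (continuous_const (y := (1:ℝ)))
    refine tendsto_integral_filter_of_dominated_convergence (fun u => |K u| * (|p s₀| + 1)) ?_ ?_ ?_ ?_
    · refine Eventually.of_forall fun n => Measurable.aestronglyMeasurable ?_
      refine hK_meas.mul (hp_meas.comp ?_)
      exact (continuous_const.add (Continuous.matrix_mulVec continuous_const continuous_id)).measurable
    · have hV : ∀ᶠ s in 𝓝 s₀, |p s| < |p s₀| + 1 :=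
        hp_cont.abs.eventually_lt_const (by simp)
      filter_upwards [hunif _ hV] with n hn
      refine Eventually.of_forall fun u => ?_
      rw [norm_mul, Real.norm_eq_abs, Real.norm_eq_abs]
      by_cases hu : K u = 0
      · simp [hu]
      · exact mul_le_mul_of_nonneg_left (le_of_lt (hn u hu)) (abs_nonneg _)
    · exact hKi.abs.mul_const _
    · refine Eventually.of_forall fun u => ?_
      exact (hp_cont.tendsto.comp (hBu u)).const_mul _
  have hDne : ∀ᶠ n in atTop, D n ≠ 0 := hDlim.eventually_ne hp0.ne'
  have hfi : Integrable (Function.uncurry f) (volume.prod volume) := by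
    by_contra hcon
    have : ∫ x : ℝ × (Fin d → ℝ), f x.1 x.2 = 0 := integral_undef hcon
    rw [this] at hf_int; exact zero_ne_one hf_int
  set I : ℝ → ℝ := fun b => ∫ u, Kt u * h₀ (ε + b * u) with hI
  have hN : ∀ᶠ n in atTop, N₁ n = I (b' n) * D n := by
    filter_upwards [hunif _ hff] with n hn
    have hb := hb'pos n
    rw [hN₁, integral_integral_swap]
    · rw [hD, ← integral_const_mul]
      congr 1
      ext s
      by_cases hk : K ((B n)⁻¹.mulVec (s - s₀)) = 0
      · simp [hKB, hk]
      have hs := hn _ hk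
      rw [Matrix.mulVec_mulVec, Matrix.mul_nonsing_inv _ (isUnit_iff_ne_zero.2 (hBdet n)),
        Matrix.one_mulVec, add_sub_cancel] at hs
      obtain ⟨hsU, hfs⟩ := hs
      have e : ∀ t, Ktb (b' n) (t - gm ⬝ᵥ (s - s₀) - θ₀) * KB (B n) (s - s₀) * f t s =
          (KB (B n) (s - s₀) * p s) * (Kt ((t - gm ⬝ᵥ (s - s₀) - θ₀) / b' n) / b' n *
            h₀ (t - m s₀ - gm ⬝ᵥ (s - s₀))) := by
        intro t
        rw [hfs, hKtb, hmU s hsU, sub_sub t (m s₀)]; ring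
      simp_rw [e]
      rw [integral_const_mul, aux_shift θ₀ (m s₀) _ _ hb, ← hε]
      simp only [hI]; ring
    · obtain ⟨M1, hM1⟩ := hK_bdd
      obtain ⟨M2, hM2⟩ := hKt_bdd
      refine Integrable.bdd_mul (c := (M2 / b' n) * (|(B n).det|⁻¹ * M1)) hfi
        (f := fun x : ℝ × (Fin d → ℝ) =>
          Ktb (b' n) (x.1 - gm ⬝ᵥ (x.2 - s₀) - θ₀) * KB (B n) (x.2 - s₀)) ?_ ?_
      · apply Measurable.aestronglyMeasurable
        simp_rw [hKtb, hKB]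
        refine Measurable.mul ((hKt_meas.comp ?_).div_const _) ((hK_meas.comp ?_).const_mul _)
        · apply Continuous.measurable
          simp only [dotProduct]
          fun_prop
        · exact (Continuous.matrix_mulVec continuous_const (by fun_prop)).measurable
      · refine Eventually.of_forall fun x => ?_
        rw [norm_mul, hKtb, hKB, norm_div, norm_mul, Real.norm_eq_abs, Real.norm_eq_abs, Real.norm_eq_abs,
          Real.norm_eq_abs, abs_of_pos hb, abs_of_nonneg (inv_nonneg.2 (abs_nonneg (B n).det))]
        have := (abs_nonneg _).trans (hM2 0)
        gcongr
        · exact hM2 _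
        · exact hM1 _
  have hg0 : g θ₀ s₀ = h₀ ε := by rw [hhomo s₀ hs₀U, hε]
  have hsm := aux_smooth hh₀_smooth ε hKt_meas hKt_supp hKt_bdd hKt_nonneg hKt_int hKt_even
  have hsm2 := hsm.comp_tendsto hb'0
  have hO : ((fun b : ℝ => b ^ 2) ∘ b') =O[atTop] (fun n => (b' n) ^ 2 + ((B n)ᵀ * B n).trace) := by
    refine IsBigO.of_bound 1 (Eventually.of_forall fun n => ?_)
    have htr : 0 ≤ ((B n)ᵀ * B n).trace := by
      simp only [Matrix.trace, Matrix.mul_apply, Matrix.diag, Matrix.transpose_apply]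
      exact Finset.sum_nonneg fun _ _ => Finset.sum_nonneg fun _ _ => mul_self_nonneg _
    simp only [Function.comp]
    rw [Real.norm_of_nonneg (sq_nonneg _), Real.norm_of_nonneg (by positivity)]
    linarith
  refine (hsm2.trans_isBigO hO).congr' ?_ EventuallyEq.rfl
  filter_upwards [hN, hDne] with n h1 h2
  simp only [Function.comp]
  rw [h1, mul_div_assoc, div_self h2, mul_one, hg0, hμ2Kt]
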